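/- Let 0 ≤ k ≤ n, let z_1, ..., z_n be indeterminates, and let μ be a partition with at most k parts. Then the expression Σ_{B ⊆ {1,...,n}, |B|=k} s_μ(z_B) · ε(w_{C̄}) · s_{λ(C̄)}(z_{B̄}) / ∏_{i∈B, j∉B}(z_i − z_j), for each fixed k-subset C ⊆ {1,...,n}, is a symmetric polynomial in z_1,...,z_n (i.e., lies in ℂ[z_1,...,z_n]^{S_n}); it equals, up to sign, a Schur polynomial s_ρ(z_1,...,z_n) or zero. -/

import Mathlib

open Finset

noncomputable def shufflePerm {n : ℕ} (B : Finset (Fin n)) : Equiv.Perm (Fin n) :=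
  (finCongr (((Finset.card_add_card_compl B).trans (Fintype.card_fin n)).symm)).trans <|
  (finSumFinEquiv.symm).trans <|
  (Equiv.sumCongr (B.orderIsoOfFin rfl).toEquiv (Bᶜ.orderIsoOfFin rfl).toEquiv).trans <|
  (Equiv.sumCongr (Equiv.refl _) (Equiv.subtypeEquivRight (fun _ => Finset.mem_compl))).trans <|
  (Equiv.sumCompl (· ∈ B))

/-- `s_{λ(D)}(z_E)` for a subset `D` (partition `λ(D)`), as a ratio of determinants. -/
noncomputable def schurAt {F : Type*} [Field F] {n : ℕ} (z : Fin n → F)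
    (D E : Finset (Fin n)) : F :=
  if h : E.card = D.card then
    Matrix.det (Matrix.of fun (i j : Fin D.card) =>
        z (E.orderEmbOfFin h j) ^ ((D.orderEmbOfFin rfl i : Fin n) : ℕ))
    / Matrix.det (Matrix.of fun (i j : Fin D.card) =>
        z (E.orderEmbOfFin h j) ^ (i : ℕ))
  else 0

/-- `s_μ(z_E)` for a partition `μ` with at most `k` parts (given as an antitone
function `Fin k → ℕ`), evaluated at the variables indexed by a `k`-subset `E`,
as a ratio of determinants `det(z_{E_j}^{μ_{k+1−i}+i−1})/det(z_{E_j}^{i−1})`. -/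
noncomputable def schurMuAt {F : Type*} [Field F] {n k : ℕ} (z : Fin n → F)
    (μ : Fin k → ℕ) (E : Finset (Fin n)) : F :=
  if h : E.card = k then
    Matrix.det (Matrix.of fun (i j : Fin k) =>
        z (E.orderEmbOfFin h j) ^ (μ (Fin.rev i) + (i : ℕ)))
    / Matrix.det (Matrix.of fun (i j : Fin k) =>
        z (E.orderEmbOfFin h j) ^ (i : ℕ))
  else 0

/-- Laplace expansion of a determinant along a block of `k` rows; `e B` enumerates `B` followed by its
complement. -/
theorem Matrix.det_eq_sum_powersetCard {R : Type*} [CommRing R] {n k m : ℕ}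
    (r : Fin k ⊕ Fin m ≃ Fin n) (e : Finset (Fin n) → (Fin k ⊕ Fin m ≃ Fin n))
    (he : ∀ B ∈ powersetCard k (univ : Finset (Fin n)), ∀ x, x ∈ B ↔ ∃ i, e B (Sum.inl i) = x)
    (M : Matrix (Fin n) (Fin n) R) :
    M.det = ∑ B ∈ powersetCard k (univ : Finset (Fin n)),
      ((Equiv.Perm.sign (r.symm.trans (e B)) : ℤ) : R) *
        ((Matrix.of fun i j : Fin k => M (r (Sum.inl i)) (e B (Sum.inl j))).det *
        (Matrix.of fun i j : Fin m => M (r (Sum.inr i)) (e B (Sum.inr j))).det) := by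
  have hterm : ∀ B ∈ powersetCard k (univ : Finset (Fin n)),
      ((Equiv.Perm.sign (r.symm.trans (e B)) : ℤ) : R) *
        ((Matrix.of fun i j : Fin k => M (r (Sum.inl i)) (e B (Sum.inl j))).det *
        (Matrix.of fun i j : Fin m => M (r (Sum.inr i)) (e B (Sum.inr j))).det) =
      ∑ p : Equiv.Perm (Fin k) × Equiv.Perm (Fin m),
        ((Equiv.Perm.sign (r.symm.trans ((Equiv.sumCongr p.1 p.2).trans (e B))) : ℤ) : R) *
          ∏ i, M i ((r.symm.trans ((Equiv.sumCongr p.1 p.2).trans (e B))) i) := by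
    intro B _
    rw [← Matrix.det_transpose, ← Matrix.det_transpose (Matrix.of fun i j : Fin m => _),
      Matrix.det_apply', Matrix.det_apply', Finset.sum_mul_sum, ← Finset.sum_product',
      Finset.mul_sum, Finset.univ_product_univ]
    refine Finset.sum_congr rfl fun p _ => ?_
    have hs : Equiv.Perm.sign (r.symm.trans ((Equiv.sumCongr p.1 p.2).trans (e B))) =
        Equiv.Perm.sign (r.symm.trans (e B)) * (Equiv.Perm.sign p.1 * Equiv.Perm.sign p.2) := by
      have : r.symm.trans ((Equiv.sumCongr p.1 p.2).trans (e B)) =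
          (r.symm.trans (e B)) * ((r.symm.trans (Equiv.Perm.sumCongr p.1 p.2)).trans r) := by
        ext x; simp [Equiv.Perm.mul_apply]
      rw [this, Equiv.Perm.sign_mul, Equiv.Perm.sign_symm_trans_trans,
        Equiv.Perm.sign_sumCongr]
    rw [hs, ← r.prod_comp, Fintype.prod_sum_type]
    simp
    ring
  rw [Finset.sum_congr rfl hterm, ← Finset.sum_product', ← Matrix.det_transpose, Matrix.det_apply']
  symm
  refine Finset.sum_bij
    (fun q _ => r.symm.trans ((Equiv.sumCongr q.2.1 q.2.2).trans (e q.1))) ?_ ?_ ?_ ?_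
  · simp
  · rintro ⟨B, p, q⟩ hB ⟨B', p', q'⟩ hB' h
    simp only [mem_product, mem_univ, and_true] at hB hB'
    have h1 : ∀ x, e B (Equiv.sumCongr p q x) = e B' (Equiv.sumCongr p' q' x) := by
      intro x
      simpa using congrArg (fun f : Equiv.Perm (Fin n) => f (r x)) h
    have hBB : B = B' := by
      ext x
      rw [he B hB, he B' hB']
      constructor
      · rintro ⟨i, rfl⟩
        exact ⟨p' (p.symm i), by simpa using (h1 (Sum.inl (p.symm i))).symm⟩
      · rintro ⟨i, rfl⟩
        exact ⟨p (p'.symm i), by simpa using (h1 (Sum.inl (p'.symm i)))⟩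
    subst hBB
    have hp : p = p' := by
      ext i
      simpa using congrArg Fin.val (Sum.inl_injective ((e B).injective (h1 (Sum.inl i))))
    have hq : q = q' := by
      ext i
      simpa using congrArg Fin.val (Sum.inr_injective ((e B).injective (h1 (Sum.inr i))))
    rw [hp, hq]
  · intro σ _
    set B : Finset (Fin n) := univ.image fun i : Fin k => σ (r (Sum.inl i)) with hBdef
    have hB : B ∈ powersetCard k (univ : Finset (Fin n)) := by
      rw [mem_powersetCard]
      refine ⟨subset_univ _, ?_⟩
      rw [hBdef, card_image_of_injective, card_univ, Fintype.card_fin]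
      intro i j h
      simpa using h
    have hmaps : Set.MapsTo ((r.trans σ).trans (e B).symm) (Set.range Sum.inl)
        (Set.range Sum.inl) := by
      rintro _ ⟨i, rfl⟩
      obtain ⟨j, hj⟩ := (he B hB (σ (r (Sum.inl i)))).1 (by simp [hBdef])
      exact ⟨j, by simp [← hj]⟩
    obtain ⟨⟨p, q⟩, hpq⟩ := Equiv.Perm.mem_sumCongrHom_range_of_perm_mapsTo_inl hmaps
    refine ⟨⟨B, p, q⟩, by simpa using hB, ?_⟩
    ext x
    have := congrArg (fun f : Equiv.Perm (Fin k ⊕ Fin m) => e B (f (r.symm x))) hpq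
    simp at this
    simp [this]
  · intro q _
    simp [Matrix.transpose_apply]

/-- The Vandermonde determinant with exponents along rows. -/
theorem Matrix.det_pow_eq_prod {R : Type*} [CommRing R] {n : ℕ} (z : Fin n → R) :
    (Matrix.of fun i j : Fin n => z j ^ (i : ℕ)).det = ∏ i, ∏ j ∈ Ioi i, (z j - z i) := by
  rw [← Matrix.det_vandermonde, ← Matrix.det_transpose]
  rfl

theorem Matrix.det_pow_ne_zero {F : Type*} [Field F] {n : ℕ} {z : Fin n → F}
    (hz : Function.Injective z) : (Matrix.of fun i j : Fin n => z j ^ (i : ℕ)).det ≠ 0 := by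
  rw [← Matrix.det_transpose]
  exact Matrix.det_vandermonde_ne_zero_iff.2 hz

theorem Matrix.det_pow_add {R : Type*} [CommRing R] {k m : ℕ} (z : Fin (k + m) → R) :
    (Matrix.of fun i j : Fin (k + m) => z j ^ (i : ℕ)).det =
      (Matrix.of fun i j : Fin k => z (Fin.castAdd m j) ^ (i : ℕ)).det *
      (Matrix.of fun i j : Fin m => z (Fin.natAdd k j) ^ (i : ℕ)).det *
      ∏ i : Fin k, ∏ j : Fin m, (z (Fin.natAdd k j) - z (Fin.castAdd m i)) := by
  have key : ∀ {l : ℕ} (w : Fin l → R), ∏ i, ∏ j ∈ Ioi i, (w j - w i) =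
      ∏ i, ∏ j, if i < j then w j - w i else 1 := by
    intro l w
    refine Finset.prod_congr rfl fun i _ => ?_
    rw [← Finset.prod_filter]
    congr 1
    ext; simp
  simp only [Matrix.det_pow_eq_prod, key, Fin.prod_univ_add, Finset.prod_mul_distrib]
  have h1 : ∀ (i : Fin m) (j : Fin k), ¬ Fin.natAdd k i < Fin.castAdd m j := by
    intro i j; simp [Fin.lt_def]; omega
  have h2 : ∀ (i : Fin k) (j : Fin m), Fin.castAdd m i < Fin.natAdd k j := by
    intro i j; simp [Fin.lt_def]; omega
  have h3 : ∀ i j : Fin k, Fin.castAdd m i < Fin.castAdd m j ↔ i < j := fun i j => Iff.rfl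
  simp only [h1, h2, h3, Fin.natAdd_lt_natAdd_iff, if_true, if_false, Finset.prod_const_one]
  ring

theorem Matrix.det_pow_comp {R : Type*} [CommRing R] {n : ℕ} (z : Fin n → R)
    (ρ : Fin n → ℕ) (σ : Equiv.Perm (Fin n)) :
    (Matrix.of fun i j : Fin n => z (σ j) ^ ρ i).det =
      ((Equiv.Perm.sign σ : ℤ) : R) * (Matrix.of fun i j : Fin n => z j ^ ρ i).det := by
  rw [← Matrix.det_permute' σ]
  rfl

theorem MvPolynomial.irreducible_X_sub_X {σ F : Type*} [Field F] {i j : σ} (h : i ≠ j) :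
    Irreducible (X i - X j : MvPolynomial σ F) := by
  classical
  have hX : (X i - X j : MvPolynomial σ F) =
      sumSMulX (Finsupp.single i 1 - Finsupp.single j 1 : σ →₀ F) := by
    simp [sumSMulX]
  have hi : (Finsupp.single i 1 - Finsupp.single j 1 : σ →₀ F) i = 1 := by
    simp [h.symm]
  rw [hX]
  refine irreducible_sumSMulX (c := Finsupp.single i 1 - Finsupp.single j 1)
    ⟨i, by rw [Finsupp.mem_support_iff, hi]; exact one_ne_zero⟩ fun r hr => ?_
  exact isUnit_of_dvd_one (hi ▸ hr i)

theorem MvPolynomial.X_sub_X_dvd_det {σ R : Type*} [CommRing R] {ι : Type*} [Fintype ι]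
    [DecidableEq ι] (v : ι → σ) (ρ : ι → ℕ) {i j : ι} (h : i ≠ j) :
    (X (v i) - X (v j) : MvPolynomial σ R) ∣
      (Matrix.of fun a b : ι => (X (v b) : MvPolynomial σ R) ^ ρ a).det := by
  rw [← Ideal.mem_span_singleton, ← Ideal.Quotient.eq_zero_iff_mem, RingHom.map_det]
  refine Matrix.det_zero_of_column_eq h fun a => ?_
  have : Ideal.Quotient.mk (Ideal.span {(X (v i) - X (v j) : MvPolynomial σ R)}) (X (v i)) =
      Ideal.Quotient.mk _ (X (v j)) := by
    rw [Ideal.Quotient.eq]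
    exact Ideal.mem_span_singleton_self _
  simp [this]

theorem MvPolynomial.isRelPrime_X_sub_X {n : ℕ} {i j i' j' : Fin n} (h : i < j) (h' : i' < j')
    (hne : ¬(i = i' ∧ j = j')) :
    IsRelPrime (X j - X i : MvPolynomial (Fin n) ℂ) (X j' - X i') := by
  rw [(irreducible_X_sub_X h.ne').isRelPrime_iff_not_dvd]
  intro hd
  have := map_dvd (eval fun t : Fin n => if t = i ∨ t = j then (0 : ℂ) else ((t + 1 : ℕ) : ℂ)) hd
  simp only [map_sub, eval_X] at this
  simp only [or_true, true_or, if_true, sub_zero, zero_dvd_iff, sub_eq_zero] at this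
  split_ifs at this with h1 h2 h2
  · omega
  · exact absurd this.symm (Nat.cast_ne_zero.2 (by omega))
  · exact absurd this (Nat.cast_ne_zero.2 (by omega))
  · have := Nat.cast_injective this
    omega

/-- The quotient of an alternant by the Vandermonde determinant is a symmetric polynomial. -/
theorem exists_isSymmetric_mul_det {n : ℕ} (ρ : Fin n → ℕ) :
    ∃ P : MvPolynomial (Fin n) ℂ, P.IsSymmetric ∧
      P * (Matrix.of fun i j : Fin n => (MvPolynomial.X j : MvPolynomial (Fin n) ℂ) ^ (i : ℕ)).det
        = (Matrix.of fun i j : Fin n => (MvPolynomial.X j : MvPolynomial (Fin n) ℂ) ^ ρ i).det := by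
  have hdvd : (Matrix.of fun i j : Fin n =>
      (MvPolynomial.X j : MvPolynomial (Fin n) ℂ) ^ (i : ℕ)).det ∣
      (Matrix.of fun i j : Fin n => (MvPolynomial.X j : MvPolynomial (Fin n) ℂ) ^ ρ i).det := by
    rw [Matrix.det_pow_eq_prod, Finset.prod_sigma']
    refine Finset.prod_dvd_of_isRelPrime ?_ ?_
    · rintro ⟨i, j⟩ hij ⟨i', j'⟩ hij' hne
      simp only [coe_sigma, Set.mem_sigma_iff, coe_univ, Set.mem_univ, true_and, mem_coe,
        mem_Ioi] at hij hij'
      refine MvPolynomial.isRelPrime_X_sub_X hij hij' ?_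
      rintro ⟨rfl, rfl⟩
      exact hne rfl
    · rintro ⟨i, j⟩ hij
      simp only [mem_sigma, mem_univ, true_and, mem_Ioi] at hij
      exact MvPolynomial.X_sub_X_dvd_det id ρ hij.ne'
  obtain ⟨P, hP⟩ := hdvd
  have hren : ∀ (σ : Equiv.Perm (Fin n)) (τ : Fin n → ℕ), MvPolynomial.rename σ
      (Matrix.of fun i j : Fin n => (MvPolynomial.X j : MvPolynomial (Fin n) ℂ) ^ τ i).det =
      ((Equiv.Perm.sign σ : ℤ) : MvPolynomial (Fin n) ℂ) *
      (Matrix.of fun i j : Fin n => (MvPolynomial.X j : MvPolynomial (Fin n) ℂ) ^ τ i).det := by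
    intro σ τ
    rw [← Matrix.det_pow_comp, AlgHom.map_det]
    congr 1
    ext1 i j
    simp
  refine ⟨P, fun σ => ?_, by rw [mul_comm, hP]⟩
  have h := congrArg (MvPolynomial.rename σ) hP
  rw [map_mul, hren σ ρ, hren σ (fun i => (i : ℕ)), hP, mul_assoc] at h
  have hu : ((Equiv.Perm.sign σ : ℤ) : MvPolynomial (Fin n) ℂ) ≠ 0 := by
    rcases Int.units_eq_one_or (Equiv.Perm.sign σ) with h | h <;> simp [h]
  have hV : (Matrix.of fun i j : Fin n =>
      (MvPolynomial.X j : MvPolynomial (Fin n) ℂ) ^ (i : ℕ)).det ≠ 0 := by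
    rw [← Matrix.det_transpose]
    exact Matrix.det_vandermonde_ne_zero_iff.2 MvPolynomial.X_injective
  exact (mul_left_cancel₀ hV (mul_left_cancel₀ hu h)).symm

/-- An alternant is zero or, up to sign, an alternant with increasing exponents. -/
theorem exists_strictMono_det_eq {n : ℕ} (e : Fin n → ℕ) :
    ∃ (c : ℂ) (ρ : Fin n → ℕ), (c = 0 ∨ c = 1 ∨ c = -1) ∧ StrictMono ρ ∧
      ∀ z : Fin n → ℂ, (Matrix.of fun i j : Fin n => z j ^ e i).det =
        c * (Matrix.of fun i j : Fin n => z j ^ ρ i).det := by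
  by_cases he : Function.Injective e
  · refine ⟨((Equiv.Perm.sign (Tuple.sort e)⁻¹ : ℤ) : ℂ), e ∘ Tuple.sort e, Or.inr ?_,
      (Tuple.monotone_sort e).strictMono_of_injective (he.comp (Equiv.injective _)), fun z => ?_⟩
    · rcases Int.units_eq_one_or (Equiv.Perm.sign (Tuple.sort e)⁻¹) with h | h <;> simp [h]
    · rw [← Matrix.det_permute]
      congr 1
      ext i j
      simp
  · obtain ⟨i, j, hij, hne⟩ := Function.not_injective_iff.1 he
    refine ⟨0, fun i => i, Or.inl rfl, fun _ _ h => h, fun z => ?_⟩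
    rw [zero_mul]
    exact Matrix.det_zero_of_row_eq hne (by ext; simp [hij])

/-- Summing products of bialternants in `B` and its complement over all `k`-subsets `B` gives a
bialternant in all variables. -/
theorem sum_bialternant_div_eq {F : Type*} [Field F] {n k m : ℕ} (h : k + m = n)
    (a : Fin k → ℕ) (b : Fin m → ℕ) {z : Fin n → F} (hz : Function.Injective z)
    (e : Finset (Fin n) → (Fin k ⊕ Fin m ≃ Fin n))
    (he : ∀ B ∈ powersetCard k (univ : Finset (Fin n)), ∀ x, x ∈ B ↔ ∃ i, e B (Sum.inl i) = x) :
    ∑ B ∈ powersetCard k (univ : Finset (Fin n)),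
      ((Matrix.of fun i j : Fin k => z (e B (Sum.inl j)) ^ a i).det /
        (Matrix.of fun i j : Fin k => z (e B (Sum.inl j)) ^ (i : ℕ)).det) *
      ((Matrix.of fun i j : Fin m => z (e B (Sum.inr j)) ^ b i).det /
        (Matrix.of fun i j : Fin m => z (e B (Sum.inr j)) ^ (i : ℕ)).det) /
        ∏ i ∈ B, ∏ j ∈ Bᶜ, (z i - z j) =
    (-1) ^ (k * m) *
      (Matrix.of fun i j : Fin n => z j ^ Fin.append a b (Fin.cast h.symm i)).det /
      (Matrix.of fun i j : Fin n => z j ^ (i : ℕ)).det := by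
  subst h
  have hV := Matrix.det_pow_ne_zero hz
  rw [Matrix.det_eq_sum_powersetCard finSumFinEquiv e he, mul_div_assoc, Finset.sum_div,
    Finset.mul_sum]
  refine Finset.sum_congr rfl fun B hB => ?_
  have hprod : ∏ i ∈ B, ∏ j ∈ Bᶜ, (z i - z j) = (-1) ^ (k * m) *
      ∏ i : Fin k, ∏ j : Fin m, (z (e B (Sum.inr j)) - z (e B (Sum.inl i))) := by
    have h1 : B = univ.map ((Function.Embedding.inl).trans (e B).toEmbedding) := by
      ext x; simp [he B hB x]
    have h2 : Bᶜ = univ.map ((Function.Embedding.inr).trans (e B).toEmbedding) := by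
      ext x
      obtain ⟨y, rfl⟩ := (e B).surjective x
      rw [mem_compl, he B hB]
      rcases y with y | y <;> simp
    have h3 : ∏ i ∈ B, ∏ j ∈ Bᶜ, (z i - z j) =
        ∏ i : Fin k, ∏ j : Fin m, (z (e B (Sum.inl i)) - z (e B (Sum.inr j))) := by
      trans ∏ i ∈ univ.map ((Function.Embedding.inl).trans (e B).toEmbedding),
        ∏ j ∈ univ.map ((Function.Embedding.inr).trans (e B).toEmbedding), (z i - z j)
      · rw [← h1, ← h2]
      · simp
    have h4 : ((-1 : F)) ^ (k * m) = ∏ i : Fin k, ∏ j : Fin m, (-1 : F) := by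
      simp [← pow_mul, mul_comm]
    rw [h3, h4]
    simp only [← Finset.prod_mul_distrib]
    simp
  set s := Equiv.Perm.sign (finSumFinEquiv.symm.trans (e B)) with hs
  have hcomp := Matrix.det_pow_comp z (fun i => (i : ℕ)) (finSumFinEquiv.symm.trans (e B))
  rw [Matrix.det_pow_add (fun j => z (finSumFinEquiv.symm.trans (e B) j)), ← hs] at hcomp
  simp only [Equiv.trans_apply, finSumFinEquiv_symm_apply_castAdd,
    finSumFinEquiv_symm_apply_natAdd] at hcomp
  have hs2 : ((s : ℤ) : F) * ((s : ℤ) : F) = 1 := by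
    rcases Int.units_eq_one_or s with h | h <;> simp [h]
  have hm2 : ((-1 : F) ^ (k * m)) * ((-1 : F) ^ (k * m)) = 1 := by
    rw [← mul_pow]; simp
  rw [hprod]
  have hs0 : ((s : ℤ) : F) ≠ 0 := left_ne_zero_of_mul_eq_one hs2
  have hm0 : (-1 : F) ^ (k * m) ≠ 0 := left_ne_zero_of_mul_eq_one hm2
  have hne := mul_ne_zero hs0 hV
  rw [← hcomp] at hne
  have hne1 := left_ne_zero_of_mul (left_ne_zero_of_mul hne)
  have hne2 := right_ne_zero_of_mul (left_ne_zero_of_mul hne)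
  have hne3 := right_ne_zero_of_mul hne
  simp only [finSumFinEquiv_apply_left, finSumFinEquiv_apply_right, Fin.cast_eq_self,
    Matrix.of_apply, Fin.append_left, Fin.append_right]
  generalize (Matrix.of fun i j : Fin (k + m) => z j ^ (i : ℕ)).det = V at *
  have hVe : V = ((s : ℤ) : F) * (((s : ℤ) : F) * V) := by rw [← mul_assoc, hs2, one_mul]
  rw [← hcomp] at hVe
  rw [hVe]
  field_simp
  linear_combination (-(Matrix.of fun i j => z ((e B) (Sum.inl j)) ^ a i).det *
    (Matrix.of fun i j => z ((e B) (Sum.inr j)) ^ b i).det) * hm2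

/-- for a partition `μ` with at most `k` parts and a fixed `k`-subset
`C ⊆ {1,…,n}`, the expression
`Σ_{|B|=k} s_μ(z_B) ε(w_{C̄}) s_{λ(C̄)}(z_{B̄}) / ∏_{i∈B,j∉B}(z_i−z_j)`
is a symmetric polynomial in `z₁,…,z_n`, and it equals, up to sign,
a Schur polynomial `s_ρ(z₁,…,z_n)` (a bialternant ratio with strictly
increasing exponents) or zero. -/
theorem sum_is_symmetric_schur (n k : ℕ) (hk : k ≤ n)
    (μ : Fin k → ℕ) (hμ : Antitone μ)
    (C : Finset (Fin n)) (hC : C.card = k) :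
    (∃ P : MvPolynomial (Fin n) ℂ, P.IsSymmetric ∧
      ∀ z : Fin n → ℂ, Function.Injective z →
        (∑ B ∈ Finset.powersetCard k (Finset.univ : Finset (Fin n)),
            schurMuAt z μ B * ((Equiv.Perm.sign (shufflePerm Cᶜ) : ℤ) : ℂ)
              * schurAt z Cᶜ Bᶜ / ∏ i ∈ B, ∏ j ∈ Bᶜ, (z i - z j))
          = MvPolynomial.eval z P)
    ∧ (∃ (c : ℂ) (ρ : Fin n → ℕ), (c = 0 ∨ c = 1 ∨ c = -1) ∧ StrictMono ρ ∧
        ∀ z : Fin n → ℂ, Function.Injective z →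
          (∑ B ∈ Finset.powersetCard k (Finset.univ : Finset (Fin n)),
              schurMuAt z μ B * ((Equiv.Perm.sign (shufflePerm Cᶜ) : ℤ) : ℂ)
                * schurAt z Cᶜ Bᶜ / ∏ i ∈ B, ∏ j ∈ Bᶜ, (z i - z j))
            = c * Matrix.det (Matrix.of fun (i j : Fin n) => z j ^ (ρ i))
                / Matrix.det (Matrix.of fun (i j : Fin n) => z j ^ (i : ℕ))) := by
  obtain ⟨c, ρ, hc, hρ, hcρ⟩ := exists_strictMono_det_eq fun i : Fin n =>
    Fin.append (fun i : Fin k => μ (Fin.rev i) + (i : ℕ))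
      (fun i : Fin Cᶜ.card => ((Cᶜ.orderEmbOfFin rfl i : Fin n) : ℕ))
      (Fin.cast (by rw [← hC, card_add_card_compl, Fintype.card_fin]) i)
  have hmain : ∃ (c : ℂ) (ρ : Fin n → ℕ), (c = 0 ∨ c = 1 ∨ c = -1) ∧ StrictMono ρ ∧
        ∀ z : Fin n → ℂ, Function.Injective z →
          (∑ B ∈ Finset.powersetCard k (Finset.univ : Finset (Fin n)),
              schurMuAt z μ B * ((Equiv.Perm.sign (shufflePerm Cᶜ) : ℤ) : ℂ)
                * schurAt z Cᶜ Bᶜ / ∏ i ∈ B, ∏ j ∈ Bᶜ, (z i - z j))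
            = c * Matrix.det (Matrix.of fun (i j : Fin n) => z j ^ (ρ i))
                / Matrix.det (Matrix.of fun (i j : Fin n) => z j ^ (i : ℕ)) := by
    refine ⟨((Equiv.Perm.sign (shufflePerm Cᶜ) : ℤ) : ℂ) * (-1) ^ (k * Cᶜ.card) * c, ρ, ?_, hρ,
      fun z hz => ?_⟩
    · rcases Int.units_eq_one_or (Equiv.Perm.sign (shufflePerm Cᶜ)) with h | h <;>
      rcases neg_one_pow_eq_or ℂ (k * Cᶜ.card) with h' | h' <;>
      rcases hc with rfl | rfl | rfl <;> simp [h, h']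
    have hcard : k + Cᶜ.card = n := by rw [← hC, card_add_card_compl, Fintype.card_fin]
    have hcompl : ∀ B : Finset (Fin n), B.card = k → Bᶜ.card = Cᶜ.card := by
      intro B hB
      rw [card_compl, card_compl, hB, hC]
    let e : Finset (Fin n) → (Fin k ⊕ Fin Cᶜ.card ≃ Fin n) := fun B =>
      if h : B.card = k then finSumEquivOfFinset h (hcompl B h)
      else finSumFinEquiv.trans (finCongr hcard)
    have he : ∀ B ∈ powersetCard k (univ : Finset (Fin n)), ∀ x,
        x ∈ B ↔ ∃ i, e B (Sum.inl i) = x := by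
      intro B hB x
      have hB' := (mem_powersetCard.1 hB).2
      simp only [e, dif_pos hB', finSumEquivOfFinset_inl]
      rw [← mem_coe, ← range_orderEmbOfFin B hB', Set.mem_range]
    have key := sum_bialternant_div_eq hcard (fun i : Fin k => μ (Fin.rev i) + (i : ℕ))
      (fun i : Fin Cᶜ.card => ((Cᶜ.orderEmbOfFin rfl i : Fin n) : ℕ)) hz e he
    rw [hcρ z] at key
    rw [mul_assoc, mul_assoc, mul_div_assoc, ← mul_assoc ((-1 : ℂ) ^ _) c, mul_assoc _ c, ← key,
      Finset.mul_sum]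
    refine Finset.sum_congr rfl fun B hB => ?_
    have hB' := (mem_powersetCard.1 hB).2
    simp only [schurMuAt, schurAt, dif_pos hB', dif_pos (hcompl B hB'), e,
      finSumEquivOfFinset_inl, finSumEquivOfFinset_inr]
    ring
  refine ⟨?_, hmain⟩
  obtain ⟨c, ρ, -, -, h⟩ := hmain
  obtain ⟨P, hP, hPV⟩ := exists_isSymmetric_mul_det ρ
  refine ⟨MvPolynomial.C c * P, (MvPolynomial.IsSymmetric.C c).mul hP, fun z hz => ?_⟩
  have hev : ∀ τ : Fin n → ℕ, MvPolynomial.eval z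
      (Matrix.of fun i j : Fin n => (MvPolynomial.X j : MvPolynomial (Fin n) ℂ) ^ τ i).det =
      (Matrix.of fun i j : Fin n => z j ^ τ i).det := by
    intro τ
    rw [RingHom.map_det]
    congr 1
    ext1 i j
    simp
  have hPz := congrArg (MvPolynomial.eval z) hPV
  rw [map_mul, hev ρ, hev fun i => (i : ℕ)] at hPz
  rw [h z hz, ← hPz, ← mul_assoc, mul_div_cancel_right₀ _ (Matrix.det_pow_ne_zero hz), map_mul,
    MvPolynomial.eval_C]
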